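/- Let G be a connected weighted partial 2-tree that is not outerplanar, let {u,v} be a vertex separator of G such that G − {u,v} has at least three components, let H be a component of G − {u,v} with V(lsp(u,v)) ∩ V(H) = ∅ and E(lsp(u,v)) ∩ E(H) = ∅, and let G₁, G₂ be obtained by decomp(G,u,v). Then for each i ∈ {1,2} and every two vertices x, y ∈ V(G_i), the lex shortest path lsp(x,y) of G is contained in G_i. -/

import Mathlib

/-!
Common definitions for formalizing "Minimum Cycle Basis in Weighted Partial 2-trees".
-/

namespace LexMCB

open SimpleGraph

variable {V : Type*}

/-- The weight of a walk: the sum of the weights of its edges. -/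
def walkWeight {G : SimpleGraph V} (w : Sym2 V → ℕ) {a b : V} (p : G.Walk a b) : ℕ :=
  (p.edges.map w).sum

/-- A walk is contained in the subgraph described by vertex set `V₁` and edge set `E₁`. -/
def WalkIn {G : SimpleGraph V} (V₁ : Set V) (E₁ : Set (Sym2 V)) {a b : V}
    (p : G.Walk a b) : Prop :=
  (∀ t ∈ p.support, t ∈ V₁) ∧ ∀ e ∈ p.edges, e ∈ E₁

/-- `p` is lexicographically better than `q`: either it has smaller weight, or equal weight
and fewer edges, or equal weight and equally many edges and
`min (V(q) \ V(p)) > min (V(p) \ V(q))`. -/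
def LexBetter [LinearOrder V] {G : SimpleGraph V} (w : Sym2 V → ℕ) {a b : V}
    (p q : G.Walk a b) : Prop :=
  walkWeight w p < walkWeight w q ∨
    (walkWeight w q = walkWeight w p ∧ p.length < q.length) ∨
    (walkWeight w q = walkWeight w p ∧ q.length = p.length ∧
      (p.support.toFinset \ q.support.toFinset).min <
        (q.support.toFinset \ p.support.toFinset).min)

/-- `p` is the lex shortest path between its endpoints among the paths lying in the
subgraph described by vertex set `V₁` and edge set `E₁`. -/
def IsLexShortestPathIn [LinearOrder V] {G : SimpleGraph V} (w : Sym2 V → ℕ)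
    (V₁ : Set V) (E₁ : Set (Sym2 V)) {a b : V} (p : G.Walk a b) : Prop :=
  p.IsPath ∧ WalkIn V₁ E₁ p ∧
    ∀ q : G.Walk a b, q.IsPath → WalkIn V₁ E₁ q → q ≠ p → LexBetter w p q

/-- `p` is the lex shortest path of `G` between its endpoints. -/
def IsLexShortestPath [LinearOrder V] {G : SimpleGraph V} (w : Sym2 V → ℕ)
    {a b : V} (p : G.Walk a b) : Prop :=
  IsLexShortestPathIn w Set.univ G.edgeSet p

/-- A (sub)graph is a cycle: it is connected and every vertex has degree two. -/
def IsCycleSubgraph {G : SimpleGraph V} (C : G.Subgraph) : Prop :=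
  C.Connected ∧ ∀ t ∈ C.verts, (C.neighborSet t).ncard = 2

/-- `C` is a lex short cycle of the subgraph of `G` described by vertex set `V₁` and
edge set `E₁`: it is a cycle lying there, and for any two distinct vertices `x,y` of `C`
the lex shortest `x`-`y` path of that subgraph is contained in `C`. -/
def IsLexShortCycleIn [LinearOrder V] {G : SimpleGraph V} (w : Sym2 V → ℕ)
    (V₁ : Set V) (E₁ : Set (Sym2 V)) (C : G.Subgraph) : Prop :=
  C.verts ⊆ V₁ ∧ C.edgeSet ⊆ E₁ ∧ IsCycleSubgraph C ∧
    ∀ x ∈ C.verts, ∀ y ∈ C.verts, x ≠ y →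
      ∀ p : G.Walk x y, IsLexShortestPathIn w V₁ E₁ p → ∀ e ∈ p.edges, e ∈ C.edgeSet

/-- The set of lex short cycles of the subgraph of `G` described by `V₁`, `E₁`. -/
def LSCIn [LinearOrder V] (G : SimpleGraph V) (w : Sym2 V → ℕ)
    (V₁ : Set V) (E₁ : Set (Sym2 V)) : Set G.Subgraph :=
  {C | IsLexShortCycleIn w V₁ E₁ C}

/-- The set of lex short cycles of `G`. -/
def LSC [LinearOrder V] (G : SimpleGraph V) (w : Sym2 V → ℕ) : Set G.Subgraph :=
  LSCIn G w Set.univ G.edgeSet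

/-! ### Components and separators -/

/-- The edges of `G` lying within the vertex set `H`. -/
def edgesWithin (G : SimpleGraph V) (H : Set V) : Set (Sym2 V) :=
  {e | e ∈ G.edgeSet ∧ ∀ t ∈ e, t ∈ H}

/-- `H` is (the vertex set of) a connected component of the induced subgraph `G[A]`:
it is a maximal subset of `A` inducing a connected subgraph. -/
def IsComponentOf (G : SimpleGraph V) (A : Set V) (H : Set V) : Prop :=
  H.Nonempty ∧ H ⊆ A ∧ (G.induce H).Connected ∧
    ∀ K : Set V, H ⊆ K → K ⊆ A → (G.induce K).Connected → K = H

/-- `{u, v}` is a vertex separator of `G` : deleting `u` and `v` disconnects `G`. -/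
def IsSeparatorPair (G : SimpleGraph V) (u v : V) : Prop :=
  ¬ (G.induce {t | t ≠ u ∧ t ≠ v}).Connected

/-- The number of connected components of `G - {u, v}`. -/
noncomputable def numComponentsDel (G : SimpleGraph V) (u v : V) : ℕ :=
  Nat.card ((G.induce {t | t ≠ u ∧ t ≠ v}).ConnectedComponent)

/-! ### Subdivisions of `K₄` and `K_{2,3}`, outerplanarity -/

/-- The interior (internal vertices) of a walk. -/
def walkInterior {G : SimpleGraph V} {a b : V} (p : G.Walk a b) : Set V :=
  {t | t ∈ p.support} \ {a, b}

/-- A `K_{2,3}`-subdivision in `G` with branch vertices `u, v` (the side of size two)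
and `x, y, z` (the side of size three): six internally disjoint paths joining each of
`u, v` to each of `x, y, z`, whose interiors avoid the branch vertices. -/
structure K23Subdiv (G : SimpleGraph V) (u v x y z : V) where
  pux : G.Walk u x
  puy : G.Walk u y
  puz : G.Walk u z
  pvx : G.Walk v x
  pvy : G.Walk v y
  pvz : G.Walk v z
  branch_nodup : List.Pairwise (· ≠ ·) [u, v, x, y, z]
  isPath_pux : pux.IsPath
  isPath_puy : puy.IsPath
  isPath_puz : puz.IsPath
  isPath_pvx : pvx.IsPath
  isPath_pvy : pvy.IsPath
  isPath_pvz : pvz.IsPath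
  interiors_disjoint : List.Pairwise Disjoint
    [walkInterior pux, walkInterior puy, walkInterior puz,
     walkInterior pvx, walkInterior pvy, walkInterior pvz]
  interiors_avoid_branch : ∀ s ∈ [walkInterior pux, walkInterior puy, walkInterior puz,
      walkInterior pvx, walkInterior pvy, walkInterior pvz],
    ∀ t ∈ s, t ∉ ({u, v, x, y, z} : Set V)

/-- The vertex set of a `K_{2,3}`-subdivision. -/
def K23Subdiv.vertSet {G : SimpleGraph V} {u v x y z : V} (K : K23Subdiv G u v x y z) :
    Set V :=
  {t | t ∈ K.pux.support ∨ t ∈ K.puy.support ∨ t ∈ K.puz.support ∨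
       t ∈ K.pvx.support ∨ t ∈ K.pvy.support ∨ t ∈ K.pvz.support}

/-- The edge set of a `K_{2,3}`-subdivision. -/
def K23Subdiv.edges {G : SimpleGraph V} {u v x y z : V} (K : K23Subdiv G u v x y z) :
    Set (Sym2 V) :=
  {e | e ∈ K.pux.edges ∨ e ∈ K.puy.edges ∨ e ∈ K.puz.edges ∨
       e ∈ K.pvx.edges ∨ e ∈ K.pvy.edges ∨ e ∈ K.pvz.edges}

/-- `G` contains a subdivision of `K_{2,3}`. -/
def HasK23Subdivision (G : SimpleGraph V) : Prop :=
  ∃ u v x y z : V, Nonempty (K23Subdiv G u v x y z)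

/-- The subgraph `S` of `G` is (exactly) a `K_{2,3}`-subdivision. -/
def IsK23SubdivisionSubgraph {G : SimpleGraph V} (S : G.Subgraph) : Prop :=
  ∃ (u v x y z : V) (K : K23Subdiv G u v x y z),
    K.vertSet = S.verts ∧ K.edges = S.edgeSet

/-- A `K₄`-subdivision in `G` with branch vertices `a, b, c, d`. -/
structure K4Subdiv (G : SimpleGraph V) (a b c d : V) where
  pab : G.Walk a b
  pac : G.Walk a c
  pad : G.Walk a d
  pbc : G.Walk b c
  pbd : G.Walk b d
  pcd : G.Walk c d
  branch_nodup : List.Pairwise (· ≠ ·) [a, b, c, d]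
  isPath_pab : pab.IsPath
  isPath_pac : pac.IsPath
  isPath_pad : pad.IsPath
  isPath_pbc : pbc.IsPath
  isPath_pbd : pbd.IsPath
  isPath_pcd : pcd.IsPath
  interiors_disjoint : List.Pairwise Disjoint
    [walkInterior pab, walkInterior pac, walkInterior pad,
     walkInterior pbc, walkInterior pbd, walkInterior pcd]
  interiors_avoid_branch : ∀ s ∈ [walkInterior pab, walkInterior pac, walkInterior pad,
      walkInterior pbc, walkInterior pbd, walkInterior pcd],
    ∀ t ∈ s, t ∉ ({a, b, c, d} : Set V)

/-- `G` contains a subdivision of `K₄`. -/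
def HasK4Subdivision (G : SimpleGraph V) : Prop :=
  ∃ a b c d : V, Nonempty (K4Subdiv G a b c d)

/-- `G` is outerplanar.  (We use the classical combinatorial characterization:
a graph is outerplanar iff it has no subgraph that is a subdivision of `K₄` or of
`K_{2,3}`.) -/
def IsOuterplanar (G : SimpleGraph V) : Prop :=
  ¬ HasK4Subdivision G ∧ ¬ HasK23Subdivision G

/-! ### 2-trees and partial 2-trees -/

/-- Add to `G` a new vertex adjacent to (exactly) `a` and `b`. -/
def addVertexOnEdge {n : ℕ} (G : SimpleGraph (Fin n)) (a b : Fin n) :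
    SimpleGraph (Fin (n + 1)) :=
  SimpleGraph.fromRel fun i j =>
    (∃ i' j' : Fin n, i = Fin.castSucc i' ∧ j = Fin.castSucc j' ∧ G.Adj i' j') ∨
    (i = Fin.last n ∧ (j = Fin.castSucc a ∨ j = Fin.castSucc b))

/-- 2-trees, defined inductively: `K₃` is a 2-tree, and adding a new vertex whose
neighbourhood is an edge of a 2-tree again gives a 2-tree. -/
inductive IsTwoTree : ∀ {n : ℕ}, SimpleGraph (Fin n) → Prop
  | base : IsTwoTree (⊤ : SimpleGraph (Fin 3))
  | extend {n : ℕ} (G : SimpleGraph (Fin n)) (a b : Fin n) :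
      IsTwoTree G → G.Adj a b → IsTwoTree (addVertexOnEdge G a b)

/-- A partial 2-tree: a subgraph of a 2-tree. -/
def IsPartialTwoTree {W : Type*} (G : SimpleGraph W) : Prop :=
  ∃ (n : ℕ) (T : SimpleGraph (Fin n)) (f : W ↪ Fin n),
    IsTwoTree T ∧ ∀ x y : W, G.Adj x y → T.Adj (f x) (f y)

/-! ### The cycle space over `𝔽₂`, cycle bases and minimum cycle bases -/

/-- The incidence vector (over `𝔽₂`) of a subgraph, indexed by `Sym2 V`. -/
noncomputable def cycleIncVec {G : SimpleGraph V} (C : G.Subgraph) : Sym2 V → ZMod 2 :=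
  C.edgeSet.indicator fun _ => 1

/-- The cycle space of `G`: the span over `𝔽₂` of the incidence vectors of cycles. -/
def cycleSpace (G : SimpleGraph V) : Submodule (ZMod 2) (Sym2 V → ZMod 2) :=
  Submodule.span (ZMod 2) (cycleIncVec '' {C : G.Subgraph | IsCycleSubgraph C})

/-- `B` is a cycle basis of `G`: a minimum-cardinality set of cycles whose incidence
vectors span the cycle space of `G`. -/
def IsCycleBasis (G : SimpleGraph V) (B : Set G.Subgraph) : Prop :=
  (∀ C ∈ B, IsCycleSubgraph C) ∧
    Submodule.span (ZMod 2) (cycleIncVec '' B) = cycleSpace G ∧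
    ∀ B' : Set G.Subgraph, (∀ C ∈ B', IsCycleSubgraph C) →
      Submodule.span (ZMod 2) (cycleIncVec '' B') = cycleSpace G → B.ncard ≤ B'.ncard

/-- The weight of a cycle: the sum of the weights of its edges. -/
noncomputable def cycleWeight {G : SimpleGraph V} (w : Sym2 V → ℕ) (C : G.Subgraph) : ℕ :=
  ∑ᶠ e ∈ C.edgeSet, w e

/-- The total weight of a set of cycles. -/
noncomputable def basisWeight {G : SimpleGraph V} (w : Sym2 V → ℕ)
    (B : Set G.Subgraph) : ℕ :=
  ∑ᶠ C ∈ B, cycleWeight w C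

/-- `B` is a minimum cycle basis of `G`: a cycle basis of minimum total weight. -/
def IsMinimumCycleBasis (G : SimpleGraph V) (w : Sym2 V → ℕ) (B : Set G.Subgraph) : Prop :=
  IsCycleBasis G B ∧ ∀ B' : Set G.Subgraph, IsCycleBasis G B' →
    basisWeight w B ≤ basisWeight w B'

/-! ### The `decomp` operation -/

/-- The vertex set of the first part `G₁` of `decomp(G,u,v)`. -/
def decompVerts1 {G : SimpleGraph V} {u v : V} (P : G.Walk u v) (H : Set V) : Set V :=
  H ∪ {t | t ∈ P.support}

/-- The edge set of the first part `G₁` of `decomp(G,u,v)`: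
`E(H) ∪ E(lsp(u,v)) ∪ {(x,y) : x ∈ V(H), y ∈ {u,v}, (x,y) ∈ E(G)}`. -/
def decompEdges1 {G : SimpleGraph V} {u v : V} (P : G.Walk u v) (H : Set V) :
    Set (Sym2 V) :=
  edgesWithin G H ∪ {e | e ∈ P.edges} ∪
    {e | ∃ a ∈ H, ∃ c ∈ ({u, v} : Set V), G.Adj a c ∧ e = s(a, c)}


section LexShortestPaths

variable {G : SimpleGraph V} {w : Sym2 V → ℕ}

@[simp]
theorem walkWeight_append {a b c : V} (p : G.Walk a b) (q : G.Walk b c) :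
    walkWeight w (p.append q) = walkWeight w p + walkWeight w q := by
  simp [walkWeight]

@[simp]
theorem walkWeight_reverse {a b : V} (p : G.Walk a b) :
    walkWeight w p.reverse = walkWeight w p := by
  simp [walkWeight, List.sum_reverse]

theorem eq_of_mem_support_of_isPath_append {a b c t : V} {p : G.Walk a b} {q : G.Walk b c}
    (h : (p.append q).IsPath) (hp : t ∈ p.support) (hq : t ∈ q.support) : t = b := by
  by_contra hne
  exact h.ne_of_mem_support_of_append hne hp hq rfl

variable [LinearOrder V]

theorem walkWeight_bypass_le {a b : V} (p : G.Walk a b) :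
    walkWeight w p.bypass ≤ walkWeight w p :=
  (p.edges_bypass_sublist_edges.map w).sum_le_sum (by simp)

theorem length_bypass_lt_of_not_isPath {a b : V} {p : G.Walk a b} (hp : ¬ p.IsPath) :
    p.bypass.length < p.length := by
  by_contra! h
  exact hp (p.bypass_eq_self_of_length_le_length_bypass h ▸ p.bypass_isPath)

theorem LexBetter.asymm {a b : V} {p q : G.Walk a b} (h : LexBetter w p q) :
    ¬ LexBetter w q p := by
  rintro (h' | ⟨h₁', h₂'⟩ | ⟨h₁', h₂', h₃'⟩) <;>
  rcases h with h | ⟨h₁, h₂⟩ | ⟨h₁, h₂, h₃⟩ <;> first | omega | exact lt_asymm h₃ h₃'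

theorem isLexShortestPath_iff {a b : V} {p : G.Walk a b} :
    IsLexShortestPath w p ↔
      p.IsPath ∧ ∀ q : G.Walk a b, q.IsPath → q ≠ p → LexBetter w p q := by
  have hin : ∀ q : G.Walk a b, WalkIn Set.univ G.edgeSet q := fun q =>
    ⟨fun _ _ => Set.mem_univ _, fun _ he => q.edges_subset_edgeSet he⟩
  simp [IsLexShortestPath, IsLexShortestPathIn, hin]

theorem IsLexShortestPath.unique {a b : V} {p q : G.Walk a b} (hp : IsLexShortestPath w p)
    (hq : IsLexShortestPath w q) : p = q := by
  rw [isLexShortestPath_iff] at hp hq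
  by_contra h
  exact (hp.2 q hq.1 (Ne.symm h)).asymm (hq.2 p hp.1 h)

theorem IsLexShortestPath.reverse {a b : V} {p : G.Walk a b} (hp : IsLexShortestPath w p) :
    IsLexShortestPath w p.reverse := by
  rw [isLexShortestPath_iff] at hp ⊢
  refine ⟨hp.1.reverse, fun q hq hne => ?_⟩
  have h := hp.2 q.reverse hq.reverse (by rintro rfl; simp at hne)
  simpa [LexBetter] using h

theorem toFinset_support_sdiff_of_isPath_append {x y a b : V} {q₁ : G.Walk x a}
    {m q : G.Walk a b} {q₂ : G.Walk b y} (h : ((q₁.append m).append q₂).IsPath) :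
    ((q₁.append m).append q₂).support.toFinset \ ((q₁.append q).append q₂).support.toFinset =
      m.support.toFinset \ q.support.toFinset := by
  ext t
  simp only [Finset.mem_sdiff, List.mem_toFinset, Walk.mem_support_append_iff]
  refine ⟨by tauto, fun ⟨hm, hq⟩ => ⟨by tauto, ?_⟩⟩
  rintro ((h₁ | h₁) | h₁)
  · exact hq (eq_of_mem_support_of_isPath_append h.of_append_left h₁ hm ▸ q.start_mem_support)
  · exact hq h₁
  · have hm' : t ∈ (q₁.append m).support := by simp [hm]
    exact hq (eq_of_mem_support_of_isPath_append h hm' h₁ ▸ q.end_mem_support)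

theorem IsLexShortestPath.of_append_append {x y a b : V} {q₁ : G.Walk x a} {m : G.Walk a b}
    {q₂ : G.Walk b y} (h : IsLexShortestPath w ((q₁.append m).append q₂)) :
    IsLexShortestPath w m := by
  rw [isLexShortestPath_iff] at h ⊢
  obtain ⟨hpath, hbest⟩ := h
  refine ⟨hpath.of_append_left.of_append_right, fun q _ hne => ?_⟩
  by_cases hp' : ((q₁.append q).append q₂).IsPath
  · have hne' : (q₁.append q).append q₂ ≠ (q₁.append m).append q₂ := by
      intro he
      have htail : q.support.tail = m.support.tail := by
        simpa [Walk.support_append] using congrArg Walk.support he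
      exact hne (Walk.ext_support (by rw [← q.cons_tail_support, htail, m.cons_tail_support]))
    have hb := hbest _ hp' hne'
    simpa [LexBetter, toFinset_support_sdiff_of_isPath_append hpath,
      toFinset_support_sdiff_of_isPath_append hp'] using hb
  · have hlen := length_bypass_lt_of_not_isPath hp'
    have hwt := walkWeight_bypass_le (w := w) ((q₁.append q).append q₂)
    have hle : walkWeight w ((q₁.append m).append q₂) <
          walkWeight w ((q₁.append q).append q₂).bypass ∨
        walkWeight w ((q₁.append m).append q₂) =
          walkWeight w ((q₁.append q).append q₂).bypass ∧
        ((q₁.append m).append q₂).length ≤ ((q₁.append q).append q₂).bypass.length := by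
      by_cases he : ((q₁.append q).append q₂).bypass = (q₁.append m).append q₂
      · simp [he]
      · rcases hbest _ (Walk.bypass_isPath _) he with h | ⟨h₁, h₂⟩ | ⟨h₁, h₂, -⟩
        · exact .inl h
        · exact .inr ⟨h₁.symm, h₂.le⟩
        · exact .inr ⟨h₁.symm, h₂.ge⟩
    simp only [walkWeight_append, Walk.length_append] at hlen hwt hle
    rcases hle with hle | ⟨hle₁, hle₂⟩
    · exact .inl (by omega)
    · by_cases hlt : walkWeight w m < walkWeight w q
      · exact .inl hlt
      · exact .inr (.inl ⟨by omega, by omega⟩)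

theorem IsLexShortestPath.exists_between {u v a b : V} {P : G.Walk u v}
    (hP : IsLexShortestPath w P) (ha : a ∈ P.support) (hb : b ∈ P.support) :
    ∃ n : G.Walk a b, IsLexShortestPath w n ∧ n.support ⊆ P.support ∧ n.edges ⊆ P.edges := by
  obtain ⟨r, s, hrs⟩ := Walk.mem_support_iff_exists_append.mp ha
  have hb' := hb
  rw [hrs, Walk.mem_support_append_iff] at hb'
  rcases hb' with hb' | hb'
  · obtain ⟨r₁, n, rfl⟩ := Walk.mem_support_iff_exists_append.mp hb'
    subst hrs
    refine ⟨n.reverse, hP.of_append_append.reverse, fun t ht => ?_, fun e he => ?_⟩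
    · simp_all
    · simp_all
  · obtain ⟨n, r₂, rfl⟩ := Walk.mem_support_iff_exists_append.mp hb'
    rw [Walk.append_assoc] at hrs
    subst hrs
    exact ⟨n, hP.of_append_append, fun t ht => by simp [ht], fun e he => by simp [he]⟩

/-- A stretch of a lex shortest path that lies between two vertices of another lex shortest
path is contained in the latter. -/
theorem IsLexShortestPath.subset_of_mem_support {u v x y s t a b : V} {P : G.Walk u v}
    (hP : IsLexShortestPath w P) {q₁ : G.Walk x s} {r : G.Walk s t} {q₂ : G.Walk t y}
    (h : IsLexShortestPath w ((q₁.append r).append q₂)) (ha₁ : a ∈ q₁.support)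
    (ha : a ∈ P.support) (hb₂ : b ∈ q₂.support) (hb : b ∈ P.support) :
    r.support ⊆ P.support ∧ r.edges ⊆ P.edges := by
  obtain ⟨l₁, m₁, rfl⟩ := Walk.mem_support_iff_exists_append.mp ha₁
  obtain ⟨m₂, l₂, rfl⟩ := Walk.mem_support_iff_exists_append.mp hb₂
  have hassoc : ((l₁.append m₁).append r).append (m₂.append l₂) =
      (l₁.append ((m₁.append r).append m₂)).append l₂ := by
    simp [Walk.append_assoc]
  rw [hassoc] at h
  obtain ⟨n, hn, hns, hne⟩ := hP.exists_between ha hb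
  obtain rfl := h.of_append_append.unique hn
  exact ⟨fun z hz => hns (by simp [hz]), fun z hz => hne (by simp [hz])⟩

end LexShortestPaths

theorem exists_append_of_mem_edges {G : SimpleGraph V} {x y : V} {p : G.Walk x y} {e : Sym2 V}
    (he : e ∈ p.edges) : ∃ (s t : V) (h : G.Adj s t) (q₁ : G.Walk x s) (q₂ : G.Walk t y),
      e = s(s, t) ∧ p = (q₁.append h.toWalk).append q₂ := by
  induction p with
  | nil => simp at he
  | cons h p ih =>
    rw [Walk.edges_cons, List.mem_cons] at he
    rcases he with rfl | he
    · exact ⟨_, _, h, Walk.nil, p, rfl, rfl⟩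
    · obtain ⟨s, t, h', q₁, q₂, rfl, rfl⟩ := ih he
      exact ⟨s, t, h', Walk.cons h q₁, q₂, rfl, rfl⟩

theorem IsComponentOf.mem_of_adj {G : SimpleGraph V} {A H : Set V} (hH : IsComponentOf G A H)
    {a b : V} (ha : a ∈ H) (hab : G.Adj a b) (hb : b ∈ A) : b ∈ H := by
  obtain ⟨-, hHA, hconn, hmax⟩ := hH
  have hK := hmax (H ∪ {b}) Set.subset_union_left
    (Set.union_subset hHA (Set.singleton_subset_iff.mpr hb))
    (connected_induce_union hconn.preconnected
      Preconnected.of_subsingleton ha (Set.mem_singleton b) hab)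
  exact hK ▸ Or.inr rfl

theorem IsComponentOf.eq_or_eq_of_adj {G : SimpleGraph V} {u v : V} {H : Set V}
    (hH : IsComponentOf G {t | t ≠ u ∧ t ≠ v} H) {a b : V} (ha : a ∈ H) (hb : b ∉ H)
    (hab : G.Adj a b) : b = u ∨ b = v := by
  by_contra! h
  exact hb (hH.mem_of_adj ha hab h)

/-- A walk from a component of `G - {u, v}` to a vertex outside it meets every walk from `u`
to `v`. -/
theorem IsComponentOf.exists_mem_support {G : SimpleGraph V} {u v : V} {H : Set V}
    (hH : IsComponentOf G {t | t ≠ u ∧ t ≠ v} H) (P : G.Walk u v) {x y : V} (q : G.Walk x y)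
    (hx : x ∈ H) (hy : y ∉ H) : ∃ a ∈ q.support, a ∈ P.support := by
  obtain ⟨d, hd, hd₁, hd₂⟩ := q.exists_boundary_dart H hx hy
  refine ⟨d.snd, q.dart_snd_mem_support_of_mem_darts hd, ?_⟩
  rcases hH.eq_or_eq_of_adj hd₁ hd₂ d.adj with h | h <;> simp [h]

variable [Fintype V] [LinearOrder V]

theorem decomp_lsp_mem
    (G : SimpleGraph V) (w : Sym2 V → ℕ)
    (hconn : G.Connected) (h2t : IsPartialTwoTree G) (hout : ¬ IsOuterplanar G)
    (u v : V) (huv : u ≠ v) (hsep : IsSeparatorPair G u v)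
    (hcomp3 : 3 ≤ numComponentsDel G u v)
    (P : G.Walk u v) (hP : IsLexShortestPath w P)
    (H : Set V) (hH : IsComponentOf G {t | t ≠ u ∧ t ≠ v} H)
    (hHV : ∀ t ∈ P.support, t ∉ H) (hHE : ∀ e ∈ P.edges, e ∉ edgesWithin G H)
    (G₁ G₂ : G.Subgraph)
    (hV₁ : G₁.verts = decompVerts1 P H) (hE₁ : G₁.edgeSet = decompEdges1 P H)
    (hV₂ : G₂.verts = Hᶜ) (hE₂ : G₂.edgeSet = edgesWithin G Hᶜ) :
    (∀ x ∈ G₁.verts, ∀ y ∈ G₁.verts, ∀ p : G.Walk x y,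
      IsLexShortestPath w p → WalkIn G₁.verts G₁.edgeSet p) ∧
    (∀ x ∈ G₂.verts, ∀ y ∈ G₂.verts, ∀ p : G.Walk x y,
      IsLexShortestPath w p → WalkIn G₂.verts G₂.edgeSet p) := by
  have hmeet : ∀ {x y : V} (q : G.Walk x y), (x ∈ H ∧ y ∉ H) ∨ (x ∉ H ∧ y ∈ H) →
      ∃ a ∈ q.support, a ∈ P.support := by
    rintro x y q (⟨hx, hy⟩ | ⟨hx, hy⟩)
    · exact hH.exists_mem_support P q hx hy
    · simpa using hH.exists_mem_support P q.reverse hy hx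
  constructor
  · intro x hx y hy p hp
    rw [hV₁] at hx hy
    have hedges : ∀ e ∈ p.edges, e ∈ G₁.edgeSet := by
      intro e he
      obtain ⟨s, t, hst, q₁, q₂, rfl, rfl⟩ := exists_append_of_mem_edges he
      rw [hE₁]
      by_cases hs : s ∈ H <;> by_cases ht : t ∈ H
      · refine .inl (.inl ⟨hst, ?_⟩)
        simp [hs, ht]
      · exact .inr ⟨s, hs, t, hH.eq_or_eq_of_adj hs ht hst, hst, rfl⟩
      · exact .inr ⟨t, ht, s, hH.eq_or_eq_of_adj ht hs hst.symm, hst.symm, Sym2.eq_swap⟩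
      · obtain ⟨a, ha₁, ha⟩ : ∃ a ∈ q₁.support, a ∈ P.support := by
          rcases hx with hx | hx
          · exact hmeet q₁ (.inl ⟨hx, hs⟩)
          · exact ⟨x, q₁.start_mem_support, hx⟩
        obtain ⟨b, hb₂, hb⟩ : ∃ b ∈ q₂.support, b ∈ P.support := by
          rcases hy with hy | hy
          · exact hmeet q₂ (.inr ⟨ht, hy⟩)
          · exact ⟨y, q₂.end_mem_support, hy⟩
        exact .inl (.inr ((hP.subset_of_mem_support hp ha₁ ha hb₂ hb).2 (by simp)))
    refine ⟨fun t ht => ?_, hedges⟩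
    rcases Walk.mem_support_iff_exists_mem_edges.mp ht with rfl | ⟨e, he, hte⟩
    · rwa [hV₁]
    · exact G₁.mem_verts_of_mem_edge (hedges e he) hte
  · intro x hx y hy p hp
    rw [hV₂] at hx hy
    have hsupp : ∀ t ∈ p.support, t ∈ Hᶜ := by
      intro t ht htH
      obtain ⟨q₁, q₂, rfl⟩ := Walk.mem_support_iff_exists_append.mp ht
      obtain ⟨a, ha₁, ha⟩ := hmeet q₁ (.inr ⟨hx, htH⟩)
      obtain ⟨b, hb₂, hb⟩ := hmeet q₂ (.inl ⟨htH, hy⟩)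
      rw [← Walk.append_nil q₁] at hp
      exact hHV t ((hP.subset_of_mem_support hp ha₁ ha hb₂ hb).1 (by simp)) htH
    rw [hV₂, hE₂]
    exact ⟨hsupp, fun e he => ⟨p.edges_subset_edgeSet he,
      fun t hte => hsupp t (Walk.mem_support_of_mem_edges he hte)⟩⟩

end LexMCB
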